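/- Let $r\geq 2$ and $n\in\mathbb{N}$. Let $\widehat{v}$ and $\widehat{u}$ be $1\times r$ row vectors of functions smooth near the origin with $\widehat{v}(0)\neq 0$ and $\widehat{u}(0)\neq 0$. Then there exists a strongly invertible $r\times r$ matrix $\widehat{U}$ of $2\pi$-periodic trigonometric polynomials such that $\widehat{u}(\xi)=\widehat{v}(\xi)\widehat{U}(\xi)+O(|\xi|^n)$ as $\xi\to 0$. -/

import Mathlib

/-- The symbol of a finitely supported matrix-valued sequence. -/
noncomputable def trigSymM {α β : Type*} (U : ℤ →₀ Matrix α β ℂ) (ξ : ℝ) : Matrix α β ℂ :=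
  U.sum fun k A => Complex.exp (-Complex.I * (k : ℂ) * (ξ : ℂ)) • A

/-- A matrix of trigonometric polynomials is strongly invertible if its pointwise inverse is
again a matrix of trigonometric polynomials. -/
def StronglyInvertible {ι : Type*} [Fintype ι] [DecidableEq ι]
    (U : ℤ →₀ Matrix ι ι ℂ) : Prop :=
  ∃ V : ℤ →₀ Matrix ι ι ℂ, ∀ ξ : ℝ,
    trigSymM U ξ * trigSymM V ξ = 1 ∧ trigSymM V ξ * trigSymM U ξ = 1

/-- `f(ξ) = g(ξ) + O(|ξ|^n)` as `ξ → 0`: derivatives at `0` agree up to order `n-1`. -/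
def derivsMatch (n : ℕ) (f g : ℝ → ℂ) : Prop :=
  ∀ j < n, iteratedDeriv j f 0 = iteratedDeriv j g 0

open Matrix in
/-- Adding to a row vector a multiple of its `i`-th entry is right multiplication by an invertible
matrix lifted along a surjection. -/
lemma exists_unit_vecMul_eq_of_eq_at {ι S Q : Type*} [Fintype ι] [DecidableEq ι] [CommRing S]
    [CommRing Q] (φ : S →+* Q) (hφ : Function.Surjective φ) (v u : ι → Q) (i : ι)
    (hi : IsUnit (v i)) (huv : u i = v i) :
    ∃ U : (Matrix ι ι S)ˣ, v ᵥ* φ.mapMatrix (U : Matrix ι ι S) = u := by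
  obtain ⟨w, hw⟩ := hi
  choose g hg using hφ
  let d : ι → S := fun k => if k = i then 0 else g ((↑w⁻¹ : Q) * (u k - v k))
  have hd : d i = 0 := by simp [d]
  let N : Matrix ι ι S := vecMulVec (Pi.single i 1) d
  have hN : N * N = 0 := by
    simp [N, vecMulVec_mul_vecMulVec, hd]
  refine ⟨⟨1 + N, 1 - N, ?_, ?_⟩, ?_⟩
  · simp [mul_sub, add_mul, hN]
  · simp [mul_add, sub_mul, hN]
  · ext k
    have hk : (v ᵥ* φ.mapMatrix N) k = v i * φ (d k) := by
      simp [N, vecMul, dotProduct, vecMulVec_apply, Pi.single_apply, apply_ite φ]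
    simp only [map_add, map_one, vecMul_add, vecMul_one, Pi.add_apply, hk]
    by_cases h : k = i
    · subst h; simp [hd, huv]
    · simp only [d, h, if_false, hg, ← hw, Units.mul_inv_cancel_left]
      ring

open Matrix in
/-- Any two rows of length at least two having an invertible entry are related by an invertible
matrix lifted along a surjection. -/
lemma exists_unit_vecMul_eq {ι S Q : Type*} [Fintype ι] [DecidableEq ι] [Nontrivial ι]
    [CommRing S] [CommRing Q] (φ : S →+* Q) (hφ : Function.Surjective φ) (v u : ι → Q)
    (hv : ∃ i, IsUnit (v i)) (hu : ∃ i, IsUnit (u i)) :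
    ∃ U : (Matrix ι ι S)ˣ, v ᵥ* φ.mapMatrix (U : Matrix ι ι S) = u := by
  have trans {a b c : ι → Q}
      (hab : ∃ U : (Matrix ι ι S)ˣ, a ᵥ* φ.mapMatrix (U : Matrix ι ι S) = b)
      (hbc : ∃ U : (Matrix ι ι S)ˣ, b ᵥ* φ.mapMatrix (U : Matrix ι ι S) = c) :
      ∃ U : (Matrix ι ι S)ˣ, a ᵥ* φ.mapMatrix (U : Matrix ι ι S) = c := by
    obtain ⟨A, rfl⟩ := hab
    obtain ⟨B, rfl⟩ := hbc
    exact ⟨A * B, by simp only [Units.val_mul, map_mul, vecMul_vecMul]⟩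
  have of_ne {a b : ι → Q} {i j : ι} (hij : i ≠ j) (ha : IsUnit (a i)) (hb : IsUnit (b j)) :
      ∃ U : (Matrix ι ι S)ˣ, a ᵥ* φ.mapMatrix (U : Matrix ι ι S) = b :=
    trans (exists_unit_vecMul_eq_of_eq_at φ hφ a (Function.update a j (b j)) i ha
        (Function.update_of_ne hij _ _))
      (exists_unit_vecMul_eq_of_eq_at φ hφ _ b j (by simpa using hb) (by simp))
  obtain ⟨i, hi⟩ := hv
  obtain ⟨j, hj⟩ := hu
  by_cases hij : i = j
  · subst hij
    obtain ⟨k, hk⟩ := exists_ne i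
    exact trans (of_ne hk.symm hi (b := 1) (by simp)) (of_ne hk (by simp) hj)
  · exact of_ne hij hi hj

/-- The algebra of functions which are smooth at the origin. -/
def smoothAtZero : Subalgebra ℂ (ℝ → ℂ) where
  carrier := {f | ContDiffAt ℝ (⊤ : ℕ∞) f 0}
  mul_mem' {f g} (hf : ContDiffAt ℝ (⊤ : ℕ∞) f 0) (hg : ContDiffAt ℝ (⊤ : ℕ∞) g 0) :=
    show ContDiffAt ℝ (⊤ : ℕ∞) (fun x => f x * g x) 0 from hf.mul hg
  add_mem' {f g} (hf : ContDiffAt ℝ (⊤ : ℕ∞) f 0) (hg : ContDiffAt ℝ (⊤ : ℕ∞) g 0) :=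
    show ContDiffAt ℝ (⊤ : ℕ∞) (fun x => f x + g x) 0 from hf.add hg
  algebraMap_mem' c := (contDiffAt_const : ContDiffAt ℝ (⊤ : ℕ∞) (fun _ : ℝ => c) 0)

lemma contDiffAt_of_smoothAtZero (f : smoothAtZero) (n : ℕ) : ContDiffAt ℝ n (f : ℝ → ℂ) 0 :=
  ContDiffAt.of_le (show ContDiffAt ℝ (⊤ : ℕ∞) (f : ℝ → ℂ) 0 from f.2) (by exact_mod_cast le_top)

/-- The ideal of functions whose derivatives of order less than `n` vanish at the origin. -/
def vanishingIdeal (n : ℕ) : Ideal smoothAtZero where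
  carrier := {f | ∀ j < n, iteratedDeriv j (f : ℝ → ℂ) 0 = 0}
  zero_mem' j _ := by
    simp
  add_mem' {f g} hf hg j hj := by
    simp [iteratedDeriv_add (contDiffAt_of_smoothAtZero f j) (contDiffAt_of_smoothAtZero g j),
      hf j hj, hg j hj]
  smul_mem' c f hf j hj := by
    simp only [smul_eq_mul, MulMemClass.coe_mul]
    rw [iteratedDeriv_mul (contDiffAt_of_smoothAtZero c j) (contDiffAt_of_smoothAtZero f j)]
    exact Finset.sum_eq_zero fun i _ => by rw [hf (j - i) (by omega), mul_zero]

lemma mk_vanishingIdeal_eq_iff {n : ℕ} {f g : smoothAtZero} :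
    Ideal.Quotient.mk (vanishingIdeal n) f = Ideal.Quotient.mk (vanishingIdeal n) g ↔
      derivsMatch n f g := by
  rw [Ideal.Quotient.eq]
  refine forall₂_congr fun j _ => ?_
  rw [AddSubgroupClass.coe_sub,
    iteratedDeriv_sub (contDiffAt_of_smoothAtZero f j) (contDiffAt_of_smoothAtZero g j),
    sub_eq_zero]

lemma isUnit_mk_vanishingIdeal {n : ℕ} {f : smoothAtZero} (hf : (f : ℝ → ℂ) 0 ≠ 0) :
    IsUnit (Ideal.Quotient.mk (vanishingIdeal n) f) := by
  let g : smoothAtZero := ⟨(f : ℝ → ℂ)⁻¹,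
    ContDiffAt.inv (show ContDiffAt ℝ (⊤ : ℕ∞) (f : ℝ → ℂ) 0 from f.2) hf⟩
  have h : Ideal.Quotient.mk (vanishingIdeal n) (f * g) = 1 := by
    rw [← map_one (Ideal.Quotient.mk (vanishingIdeal n)), mk_vanishingIdeal_eq_iff]
    intro j _
    refine Filter.EventuallyEq.iteratedDeriv_eq j ?_
    filter_upwards [(contDiffAt_of_smoothAtZero f 0).continuousAt.eventually_ne hf] with x hx
    exact mul_inv_cancel₀ hx
  refine isUnit_iff_exists.mpr ⟨Ideal.Quotient.mk _ g, ?_, ?_⟩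
  · rw [← map_mul, h]
  · rw [← map_mul, mul_comm, h]

/-- The exponentials `ξ ↦ exp (-ikξ)`, multiplicatively in the frequency `k`. -/
noncomputable def expChar : Multiplicative ℤ →* smoothAtZero where
  toFun k := ⟨fun ξ => Complex.exp (-Complex.I * (k.toAdd : ℂ) * (ξ : ℂ)), by
    change ContDiffAt ℝ (⊤ : ℕ∞) (fun ξ : ℝ => Complex.exp (-Complex.I * (k.toAdd : ℂ) * ξ)) 0
    have : ContDiff ℝ (⊤ : ℕ∞) (fun ξ : ℝ => (ξ : ℂ)) := Complex.ofRealCLM.contDiff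
    fun_prop⟩
  map_one' := by ext; simp
  map_mul' a b := by
    ext ξ
    simp only [toAdd_mul, MulMemClass.coe_mul, Pi.mul_apply, ← Complex.exp_add]
    push_cast
    ring_nf

/-- Evaluation of a Laurent polynomial as a trigonometric polynomial. -/
noncomputable def trigEval : AddMonoidAlgebra ℂ ℤ →ₐ[ℂ] smoothAtZero :=
  AddMonoidAlgebra.lift ℂ smoothAtZero ℤ expChar

lemma trigEval_single (k : ℤ) (c : ℂ) (ξ : ℝ) :
    (trigEval (.single k c) : ℝ → ℂ) ξ = c * Complex.exp (-Complex.I * (k : ℂ) * (ξ : ℂ)) := by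
  rw [trigEval, AddMonoidAlgebra.lift_single]
  rfl

lemma iteratedDeriv_exp_const_mul_ofReal (c : ℂ) (j : ℕ) :
    iteratedDeriv j (fun ξ : ℝ => Complex.exp (c * ξ)) =
      fun ξ : ℝ => c ^ j * Complex.exp (c * ξ) := by
  induction j with
  | zero => simp
  | succ j ih =>
    rw [iteratedDeriv_succ, ih]
    ext ξ
    have h : HasDerivAt (fun ξ : ℝ => c * (ξ : ℂ)) c ξ := by
      simpa using (Complex.ofRealCLM.hasDerivAt (x := ξ)).const_mul c
    rw [(h.cexp.const_mul (c ^ j)).deriv]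
    ring

/-- Every jet at the origin is the jet of a trigonometric polynomial. -/
lemma surjective_mk_comp_trigEval (n : ℕ) : Function.Surjective
    ((Ideal.Quotient.mk (vanishingIdeal n)).comp
      (trigEval : AddMonoidAlgebra ℂ ℤ →+* smoothAtZero)) := by
  intro q
  obtain ⟨f, rfl⟩ := Ideal.Quotient.mk_surjective q
  let w : Fin n → ℂ := fun k => -Complex.I * ((k : ℤ) : ℂ)
  have hw : Function.Injective w := by
    intro a b hab
    have := mul_left_cancel₀ (neg_ne_zero.mpr Complex.I_ne_zero) hab
    exact Fin.ext (by exact_mod_cast this)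
  have hdet : IsUnit (Matrix.vandermonde w) :=
    (Matrix.isUnit_iff_isUnit_det _).mpr (Matrix.det_vandermonde_ne_zero_iff.mpr hw).isUnit
  obtain ⟨c, hc⟩ := Matrix.vecMul_surjective_iff_isUnit.mpr hdet
    (fun j : Fin n => iteratedDeriv j (f : ℝ → ℂ) 0)
  refine ⟨∑ k : Fin n, .single ((k : ℕ) : ℤ) (c k), ?_⟩
  rw [RingHom.comp_apply, mk_vanishingIdeal_eq_iff]
  intro j hj
  have hfun : ((trigEval (∑ k : Fin n, .single ((k : ℕ) : ℤ) (c k)) : smoothAtZero) : ℝ → ℂ) =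
      fun ξ : ℝ => ∑ k, c k * Complex.exp (w k * ξ) := by
    ext ξ
    rw [map_sum, AddSubmonoidClass.coe_finsetSum, Finset.sum_apply]
    exact Finset.sum_congr rfl fun k _ => trigEval_single _ _ _
  have hs (k : Fin n) : ContDiffAt ℝ j (fun ξ : ℝ => Complex.exp (w k * ξ)) 0 := by
    have : ContDiff ℝ j (fun ξ : ℝ => (ξ : ℂ)) := Complex.ofRealCLM.contDiff
    fun_prop
  have hj' := congrFun hc ⟨j, hj⟩
  rw [RingHom.coe_coe, hfun, iteratedDeriv_fun_sum fun k _ => contDiffAt_const.mul (hs k), ← hj']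
  refine Finset.sum_congr rfl fun k _ => ?_
  rw [iteratedDeriv_const_mul _ (hs k), iteratedDeriv_exp_const_mul_ofReal]
  simp [Matrix.vandermonde_apply]

lemma trigSymM_add {α β : Type*} (U V : ℤ →₀ Matrix α β ℂ) (ξ : ℝ) :
    trigSymM (U + V) ξ = trigSymM U ξ + trigSymM V ξ :=
  Finsupp.sum_add_index' (fun _ => smul_zero _) (fun _ _ _ => smul_add _ _ _)

lemma trigSymM_single {α β : Type*} (k : ℤ) (A : Matrix α β ℂ) (ξ : ℝ) :
    trigSymM (Finsupp.single k A) ξ =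
      Complex.exp (-Complex.I * (k : ℂ) * (ξ : ℂ)) • A :=
  Finsupp.sum_single_index (smul_zero _)

/-- A matrix of Laurent polynomials is represented by a sequence of matrices. -/
lemma exists_trigSymM_eq {ι : Type*} [Fintype ι] [DecidableEq ι]
    (M : Matrix ι ι (AddMonoidAlgebra ℂ ℤ)) :
    ∃ U : ℤ →₀ Matrix ι ι ℂ, ∀ ξ i j, trigSymM U ξ i j = (trigEval (M i j) : ℝ → ℂ) ξ := by
  induction M using Matrix.induction_on' with
  | h_zero => exact ⟨0, fun ξ i j => by simp [trigSymM]⟩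
  | h_add p q hp hq =>
    obtain ⟨P, hP⟩ := hp
    obtain ⟨Q, hQ⟩ := hq
    exact ⟨P + Q, fun ξ i j => by simp [trigSymM_add, hP, hQ]⟩
  | h_std_basis a b x =>
    induction x using AddMonoidAlgebra.induction_linear with
    | zero => exact ⟨0, fun ξ i j => by simp [trigSymM]⟩
    | add x y hx hy =>
      obtain ⟨P, hP⟩ := hx
      obtain ⟨Q, hQ⟩ := hy
      exact ⟨P + Q, fun ξ i j => by simp [trigSymM_add, hP, hQ, Matrix.single_add]⟩
    | single k c =>
      refine ⟨Finsupp.single k (Matrix.single a b c), fun ξ i j => ?_⟩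
      rw [trigSymM_single, Matrix.smul_apply, smul_eq_mul,
        Matrix.single_apply, Matrix.single_apply]
      split_ifs
      · rw [trigEval_single, mul_comm]
      · simp

lemma trigSymM_mul_eq_one {ι : Type*} [Fintype ι] [DecidableEq ι]
    {M N : Matrix ι ι (AddMonoidAlgebra ℂ ℤ)} (hMN : M * N = 1) {U V : ℤ →₀ Matrix ι ι ℂ}
    (hU : ∀ ξ i j, trigSymM U ξ i j = (trigEval (M i j) : ℝ → ℂ) ξ)
    (hV : ∀ ξ i j, trigSymM V ξ i j = (trigEval (N i j) : ℝ → ℂ) ξ) (ξ : ℝ) :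
    trigSymM U ξ * trigSymM V ξ = 1 := by
  ext i j
  have h := congrArg (fun A => (trigEval (A i j) : ℝ → ℂ) ξ) hMN
  simp only [Matrix.mul_apply, map_sum, map_mul, AddSubmonoidClass.coe_finsetSum,
    Finset.sum_apply, MulMemClass.coe_mul, Pi.mul_apply] at h
  simp only [Matrix.mul_apply, hU, hV, h, Matrix.one_apply]
  split_ifs <;> simp

/-- Lemma 2.1: for `r ≥ 2`, `n ≥ 1`, and `1 × r` row vectors `v̂`, `û` of functions smooth near
the origin with `v̂(0) ≠ 0` and `û(0) ≠ 0`, there is a strongly invertible `r × r` matrix `Û`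
of 2π-periodic trigonometric polynomials with `û(ξ) = v̂(ξ)Û(ξ) + O(|ξ|^n)` as `ξ → 0`. -/
theorem row_transfer (r : ℕ) (hr : 2 ≤ r) (n : ℕ) (hn : 1 ≤ n)
    (v u : Fin r → ℝ → ℂ)
    (hv : ∀ i, ContDiffAt ℝ (⊤ : ℕ∞) (v i) 0) (hu : ∀ i, ContDiffAt ℝ (⊤ : ℕ∞) (u i) 0)
    (hv0 : ∃ i, v i 0 ≠ 0) (hu0 : ∃ i, u i 0 ≠ 0) :
    ∃ U : ℤ →₀ Matrix (Fin r) (Fin r) ℂ, StronglyInvertible U ∧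
      ∀ j : Fin r, derivsMatch n (u j) (fun ξ => ∑ i, v i ξ * trigSymM U ξ i j) := by
  have : Nontrivial (Fin r) := Fin.nontrivial_iff_two_le.mpr hr
  let v' : Fin r → smoothAtZero := fun i => ⟨v i, hv i⟩
  let u' : Fin r → smoothAtZero := fun i => ⟨u i, hu i⟩
  obtain ⟨M, hM⟩ := exists_unit_vecMul_eq _ (surjective_mk_comp_trigEval n)
    (fun i => Ideal.Quotient.mk (vanishingIdeal n) (v' i))
    (fun i => Ideal.Quotient.mk (vanishingIdeal n) (u' i))
    (hv0.imp fun _ h => isUnit_mk_vanishingIdeal h) (hu0.imp fun _ h => isUnit_mk_vanishingIdeal h)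
  obtain ⟨U, hU⟩ := exists_trigSymM_eq (M : Matrix (Fin r) (Fin r) (AddMonoidAlgebra ℂ ℤ))
  obtain ⟨V, hV⟩ := exists_trigSymM_eq (↑M⁻¹ : Matrix (Fin r) (Fin r) (AddMonoidAlgebra ℂ ℤ))
  refine ⟨U, ⟨V, fun ξ => ⟨trigSymM_mul_eq_one M.mul_inv hU hV ξ,
    trigSymM_mul_eq_one M.inv_mul hV hU ξ⟩⟩, fun j => ?_⟩
  have hj : Ideal.Quotient.mk (vanishingIdeal n) (u' j) =
      Ideal.Quotient.mk (vanishingIdeal n) (∑ i, v' i * trigEval (M.val i j)) := by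
    rw [← congrFun hM j]
    simp [Matrix.vecMul, dotProduct]
  convert mk_vanishingIdeal_eq_iff.mp hj using 1
  ext ξ
  simp [hU, v', AddSubmonoidClass.coe_finsetSum]
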